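/- Let σ > 0, let y_1, …, y_n ∈ ℝ^d, and let 𝒫 be any class of probability measures on ℝ^d with finite second moments (not necessarily closed under domination). Let U = (1/n) Σ_{i=1}^n δ_{y_i}. Then a measure P̂ ∈ 𝒫 maximizes the Gaussian deconvolution log-likelihood P ↦ Σ_{i=1}^n log (φ_σ ⋆ dP)(y_i) over 𝒫 if and only if P̂ minimizes over 𝒫 the relaxed entropic optimal transport distance W^{rel}_{σ²}(P, U) := inf over probability measures γ on ℝ^d × ℝ^d with second marginal U and with π_X γ ≪ P of [ ∫ (1/2)‖x − y‖² dγ(x, y) + σ² ( I(γ) + D(π_X γ ‖ P) ) ]. -/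

import Mathlib

open MeasureTheory ProbabilityTheory Real
open scoped ENNReal

noncomputable section
open Classical in

/-- The Kullback–Leibler divergence `D(μ ‖ ν)`, valued in `ℝ≥0∞`.
It equals `∫ log (dμ/dν) dμ` when `μ ≪ ν` and this integral is defined,
and `∞` otherwise.  (For probability measures the integral, when defined,
is nonnegative, so no truncation occurs.) -/
def KLdiv {α : Type*} [MeasurableSpace α] (μ ν : Measure α) : ℝ≥0∞ :=
  if μ ≪ ν ∧ Integrable (fun x => Real.log (μ.rnDeriv ν x).toReal) μ then
    ENNReal.ofReal (∫ x, Real.log (μ.rnDeriv ν x).toReal ∂μ)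
  else ⊤

/-- The mutual information `I(γ) = D(γ ‖ π_X γ ⊗ π_Y γ)` of a measure on a product space. -/
def mutualInfo {α β : Type*} [MeasurableSpace α] [MeasurableSpace β]
    (γ : Measure (α × β)) : ℝ≥0∞ :=
  KLdiv γ ((γ.map Prod.fst).prod (γ.map Prod.snd))

/-- The set of couplings of `μ` and `ν` : probability measures on the product with
first marginal `μ` and second marginal `ν`. -/
def couplings {α : Type*} [MeasurableSpace α] (μ ν : Measure α) :
    Set (Measure (α × α)) :=
  {γ | IsProbabilityMeasure γ ∧ γ.map Prod.fst = μ ∧ γ.map Prod.snd = ν}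

/-- The entropic optimal transport distance `W_{σ²}(μ, ν)`. -/
def entropicOT {E : Type*} [NormedAddCommGroup E] [MeasurableSpace E]
    (σ : ℝ) (μ ν : Measure E) : ℝ≥0∞ :=
  ⨅ γ ∈ couplings μ ν,
    (∫⁻ p, ENNReal.ofReal (‖p.1 - p.2‖ ^ 2 / 2) ∂γ)
      + ENNReal.ofReal (σ ^ 2) * mutualInfo γ

/-- The density `φ_σ` of the centered Gaussian `N(0, σ² I_d)` on `ℝ^d`. -/
def gaussDensity (σ : ℝ) (d : ℕ) (z : EuclideanSpace ℝ (Fin d)) : ℝ :=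
  (2 * π * σ ^ 2) ^ (-(d : ℝ) / 2) * Real.exp (-‖z‖ ^ 2 / (2 * σ ^ 2))

/-- The empirical measure `(1/n) ∑ δ_{y i}`. -/
def empirical {α : Type*} [MeasurableSpace α] {n : ℕ} (y : Fin n → α) : Measure α :=
  (n : ℝ≥0∞)⁻¹ • ∑ i, Measure.dirac (y i)


/-- The relaxed entropic optimal transport distance `W^{rel}_{σ²}(μ, ν)`:
the infimum over probability measures `γ` on the product with second marginal `ν`
and first marginal absolutely continuous with respect to `μ` of
`∫ (1/2)‖x − y‖² dγ + σ² (I(γ) + D(π_X γ ‖ μ))`. -/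
noncomputable def relaxedEOT {E : Type*} [NormedAddCommGroup E] [MeasurableSpace E]
    (σ : ℝ) (μ ν : Measure E) : ℝ≥0∞ :=
  ⨅ γ ∈ {γ : Measure (E × E) |
      IsProbabilityMeasure γ ∧ γ.map Prod.snd = ν ∧ γ.map Prod.fst ≪ μ},
    (∫⁻ p, ENNReal.ofReal (‖p.1 - p.2‖ ^ 2 / 2) ∂γ)
      + ENNReal.ofReal (σ ^ 2) * (mutualInfo γ + KLdiv (γ.map Prod.fst) μ)


lemma integral_llr_nonneg {α : Type*} [MeasurableSpace α] {μ ν : Measure α}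
    [IsProbabilityMeasure μ] [IsProbabilityMeasure ν] (h : μ ≪ ν) (hi : Integrable (llr μ ν) μ) :
    0 ≤ ∫ x, llr μ ν x ∂μ := by
  simpa using InformationTheory.integral_llr_add_sub_measure_univ_nonneg h hi

/-- Finite divergence means absolute continuity and integrability of the log-likelihood ratio. -/
lemma KLdiv_ne_top {α : Type*} [MeasurableSpace α] {μ ν : Measure α} (h : KLdiv μ ν ≠ ⊤) :
    μ ≪ ν ∧ Integrable (llr μ ν) μ ∧ KLdiv μ ν = ENNReal.ofReal (∫ x, llr μ ν x ∂μ) := by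
  by_cases h' : μ ≪ ν ∧ Integrable (fun x => Real.log (μ.rnDeriv ν x).toReal) μ
  · refine ⟨h'.1, h'.2, ?_⟩
    rw [KLdiv, if_pos h']
    rfl
  · rw [KLdiv, if_neg h'] at h
    exact absurd rfl h

lemma KLdiv_of_integrable {α : Type*} [MeasurableSpace α] {μ ν : Measure α} (h : μ ≪ ν)
    (hi : Integrable (llr μ ν) μ) :
    KLdiv μ ν = ENNReal.ofReal (∫ x, llr μ ν x ∂μ) := by
  have h' : μ ≪ ν ∧ Integrable (fun x => Real.log (μ.rnDeriv ν x).toReal) μ := ⟨h, hi⟩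
  rw [KLdiv, if_pos h']
  rfl

lemma lintegral_mul_inv_rnDeriv_le {α : Type*} [MeasurableSpace α] {μ ν : Measure α}
    [SigmaFinite μ] [SigmaFinite ν] (h : μ ≪ ν) {f : α → ℝ≥0∞} (hf : Measurable f) :
    ∫⁻ x, f x * (μ.rnDeriv ν x)⁻¹ ∂μ ≤ ∫⁻ x, f x ∂ν := by
  have hr := Measure.measurable_rnDeriv μ ν
  calc ∫⁻ x, f x * (μ.rnDeriv ν x)⁻¹ ∂μ
      = ∫⁻ x, f x * (μ.rnDeriv ν x)⁻¹ ∂(ν.withDensity (μ.rnDeriv ν)) := by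
        rw [Measure.withDensity_rnDeriv_eq _ _ h]
    _ = ∫⁻ x, (μ.rnDeriv ν * fun x => f x * (μ.rnDeriv ν x)⁻¹) x ∂ν :=
        lintegral_withDensity_eq_lintegral_mul _ hr (hf.mul hr.inv)
    _ ≤ ∫⁻ x, f x ∂ν := by
        refine lintegral_mono fun x => ?_
        simp only [Pi.mul_apply]
        calc μ.rnDeriv ν x * (f x * (μ.rnDeriv ν x)⁻¹)
            = f x * (μ.rnDeriv ν x * (μ.rnDeriv ν x)⁻¹) := by ring
          _ ≤ f x * 1 := by gcongr; exact ENNReal.mul_inv_le_one _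
          _ = f x := mul_one _

/-- The Gibbs variational inequality for the two-step divergence
`D(γ ‖ π_X γ ⊗ U) + D(π_X γ ‖ P)`. -/
lemma integral_log_le_integral_llr_add {α β : Type*} [MeasurableSpace α] [MeasurableSpace β]
    {P : Measure α} {U : Measure β} [IsProbabilityMeasure P] [IsProbabilityMeasure U]
    {γ : Measure (α × β)} [IsProbabilityMeasure γ]
    {F : α × β → ℝ} (hF : Measurable F) (hpos : ∀ p, 0 < F p)
    (hint : ∫⁻ p, ENNReal.ofReal (F p) ∂(P.prod U) ≤ 1)
    (hac : γ.map Prod.fst ≪ P) (hacγ : γ ≪ (γ.map Prod.fst).prod U)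
    (hlog : Integrable (fun p => Real.log (F p)) γ)
    (hi : Integrable (llr γ ((γ.map Prod.fst).prod U)) γ)
    (hi' : Integrable (llr (γ.map Prod.fst) P) (γ.map Prod.fst)) :
    ∫ p, Real.log (F p) ∂γ ≤ ∫ p, llr γ ((γ.map Prod.fst).prod U) p ∂γ
      + ∫ x, llr (γ.map Prod.fst) P x ∂(γ.map Prod.fst) := by
  have : IsProbabilityMeasure (γ.map Prod.fst) :=
    Measure.isProbabilityMeasure_map measurable_fst.aemeasurable
  set π₁ := γ.map Prod.fst with hπ₁
  set r₁ := γ.rnDeriv (π₁.prod U) with hr₁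
  set r₂ := π₁.rnDeriv P with hr₂
  have mr₁ : Measurable r₁ := Measure.measurable_rnDeriv _ _
  have mr₂ : Measurable r₂ := Measure.measurable_rnDeriv _ _
  set Z : α × β → ℝ≥0∞ := fun p => ENNReal.ofReal (F p) * (r₂ p.1)⁻¹ * (r₁ p)⁻¹ with hZ
  have mZ : Measurable Z := by fun_prop
  have hZ1 : ∫⁻ p, Z p ∂γ ≤ 1 := by
    calc ∫⁻ p, Z p ∂γ ≤ ∫⁻ p, ENNReal.ofReal (F p) * (r₂ p.1)⁻¹ ∂(π₁.prod U) :=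
          lintegral_mul_inv_rnDeriv_le hacγ
            (f := fun p => ENNReal.ofReal (F p) * (r₂ p.1)⁻¹) (by fun_prop)
      _ = ∫⁻ y, ∫⁻ x, ENNReal.ofReal (F (x, y)) * (r₂ x)⁻¹ ∂π₁ ∂U :=
          lintegral_prod_symm' _ (by fun_prop)
      _ ≤ ∫⁻ y, ∫⁻ x, ENNReal.ofReal (F (x, y)) ∂P ∂U :=
          lintegral_mono fun y => lintegral_mul_inv_rnDeriv_le hac
            (f := fun x => ENNReal.ofReal (F (x, y))) (by fun_prop)
      _ = ∫⁻ p, ENNReal.ofReal (F p) ∂(P.prod U) :=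
          (lintegral_prod_symm' (fun p => ENNReal.ofReal (F p)) (by fun_prop)).symm
      _ ≤ 1 := hint
  have hZne : ∫⁻ p, Z p ∂γ ≠ ⊤ := (hZ1.trans_lt ENNReal.one_lt_top).ne
  have hZint : Integrable (fun p => (Z p).toReal) γ :=
    integrable_toReal_of_lintegral_ne_top mZ.aemeasurable hZne
  have hZ1' : ∫ p, (Z p).toReal ∂γ ≤ 1 := by
    rw [integral_toReal mZ.aemeasurable (ae_lt_top mZ hZne)]
    exact ENNReal.toReal_le_of_le_ofReal zero_le_one (by simpa using hZ1)
  have p₁ : ∀ᵐ p ∂γ, 0 < r₁ p := Measure.rnDeriv_pos hacγ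
  have t₁ : ∀ᵐ p ∂γ, r₁ p < ⊤ := hacγ.ae_le (Measure.rnDeriv_lt_top _ _)
  have p₂ : ∀ᵐ p ∂γ, 0 < r₂ p.1 :=
    ae_of_ae_map measurable_fst.aemeasurable (Measure.rnDeriv_pos hac)
  have t₂ : ∀ᵐ p ∂γ, r₂ p.1 < ⊤ :=
    ae_of_ae_map measurable_fst.aemeasurable (hac.ae_le (Measure.rnDeriv_lt_top _ _))
  have hi'' : Integrable (fun p : α × β => llr π₁ P p.1) γ :=
    hi'.comp_measurable measurable_fst
  have e₂ : ∫ x, llr π₁ P x ∂π₁ = ∫ p, llr π₁ P p.1 ∂γ :=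
    integral_map measurable_fst.aemeasurable (measurable_llr _ _).aestronglyMeasurable
  rw [e₂]
  have key : ∫ p, (1 - (Z p).toReal) ∂γ ≤
      ∫ p, (llr γ (π₁.prod U) p + llr π₁ P p.1 - Real.log (F p)) ∂γ := by
    refine integral_mono_ae ((integrable_const _).sub hZint) ((hi.add hi'').sub hlog) ?_
    filter_upwards [p₁, t₁, p₂, t₂] with p h1 h2 h3 h4
    have a1 : 0 < (r₁ p).toReal := ENNReal.toReal_pos h1.ne' h2.ne
    have a2 : 0 < (r₂ p.1).toReal := ENNReal.toReal_pos h3.ne' h4.ne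
    have a0 := hpos p
    have hz : (Z p).toReal = F p * (r₂ p.1).toReal⁻¹ * (r₁ p).toReal⁻¹ := by
      simp [hZ, ENNReal.toReal_mul, a0.le]
    have hzpos : 0 < (Z p).toReal := by rw [hz]; positivity
    have := Real.log_le_sub_one_of_pos hzpos
    rw [hz, Real.log_mul (by positivity) (by positivity), Real.log_mul (by positivity)
      (by positivity), Real.log_inv, Real.log_inv, ← hz] at this
    simp only [llr]
    change _ ≤ Real.log (r₁ p).toReal + Real.log (r₂ p.1).toReal - _
    linarith
  rw [integral_sub (integrable_const _) hZint,
    integral_sub (f := fun p => llr γ (π₁.prod U) p + llr π₁ P p.1) (hi.add hi'') hlog,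
    integral_add hi hi''] at key
  simp only [integral_const, probReal_univ, smul_eq_mul, mul_one] at key
  linarith

/-- A conditional density `F` realizes equality in the Gibbs variational inequality. -/
lemma exists_divergence_le {α β : Type*} [MeasurableSpace α] [MeasurableSpace β]
    {P : Measure α} {U : Measure β} [IsProbabilityMeasure P] [IsProbabilityMeasure U]
    {F : α × β → ℝ} (hF : Measurable F) (hpos : ∀ p, 0 < F p)
    (hone : ∀ y, ∫⁻ x, ENNReal.ofReal (F (x, y)) ∂P = 1)
    {M : ℝ} (hM : ∀ᵐ p ∂(P.prod U), F p ≤ M)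
    (hlog : Integrable (fun p => Real.log (F p)) (P.prod U))
    (hlogq : Integrable (fun x => Real.log (∫⁻ y, ENNReal.ofReal (F (x, y)) ∂U).toReal) P) :
    ∃ γ : Measure (α × β), IsProbabilityMeasure γ ∧ γ.map Prod.snd = U ∧ γ.map Prod.fst ≪ P ∧
      γ ≤ ENNReal.ofReal M • P.prod U ∧
      mutualInfo γ + KLdiv (γ.map Prod.fst) P ≤ ENNReal.ofReal (∫ p, Real.log (F p) ∂γ) ∧
      0 ≤ ∫ p, Real.log (F p) ∂γ := by
  set γ : Measure (α × β) := (P.prod U).withDensity (fun p => ENNReal.ofReal (F p)) with hγ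
  set Q : α → ℝ≥0∞ := fun x => ∫⁻ y, ENNReal.ofReal (F (x, y)) ∂U with hQ
  have mQ : Measurable Q := Measurable.lintegral_prod_right' (f := fun p => ENNReal.ofReal (F p))
    (by fun_prop)
  have hsnd : γ.map Prod.snd = U := by
    ext s hs
    rw [Measure.map_apply measurable_snd hs, hγ, withDensity_apply _ (measurable_snd hs),
      ← lintegral_indicator (measurable_snd hs), lintegral_prod_symm' _
        ((by fun_prop : Measurable fun p => ENNReal.ofReal (F p)).indicator (measurable_snd hs))]
    have : ∀ y, ∫⁻ x, (Prod.snd ⁻¹' s).indicator (fun p => ENNReal.ofReal (F p)) (x, y) ∂P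
        = s.indicator 1 y := by
      intro y
      by_cases hy : y ∈ s
      · simp [Set.indicator, hy, hone]
      · simp [Set.indicator, hy]
    simp_rw [this]
    exact lintegral_indicator_one hs
  have hfst : γ.map Prod.fst = P.withDensity Q := by
    ext s hs
    rw [Measure.map_apply measurable_fst hs, hγ, withDensity_apply _ (measurable_fst hs),
      ← lintegral_indicator (measurable_fst hs), lintegral_prod _
        ((by fun_prop : Measurable fun p => ENNReal.ofReal (F p)).indicator
          (measurable_fst hs)).aemeasurable,
      withDensity_apply _ hs, ← lintegral_indicator hs]
    refine lintegral_congr fun x => ?_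
    by_cases hx : x ∈ s
    · simp [Set.indicator, hx, hQ]
    · simp [Set.indicator, hx]
  have hprob : IsProbabilityMeasure γ := by
    constructor
    have := congrArg (fun μ => μ Set.univ) hsnd
    simpa [Measure.map_apply measurable_snd MeasurableSet.univ] using this
  have hprob₁ : IsProbabilityMeasure (γ.map Prod.fst) :=
    Measure.isProbabilityMeasure_map measurable_fst.aemeasurable
  have hac : γ.map Prod.fst ≪ P := hfst ▸ withDensity_absolutelyContinuous _ _
  have hle : γ ≤ ENNReal.ofReal M • P.prod U := by
    rw [hγ, ← withDensity_const]
    refine withDensity_mono ?_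
    filter_upwards [hM] with p hp using ENNReal.ofReal_le_ofReal hp
  have hQ0 : ∀ x, Q x ≠ 0 := by
    intro x h
    rw [hQ, lintegral_eq_zero_iff (by fun_prop)] at h
    obtain ⟨y, hy⟩ := h.exists
    simp only [Pi.zero_apply, ENNReal.ofReal_eq_zero] at hy
    exact absurd (hpos (x, y)) (not_lt.mpr hy)
  have hQtop : ∀ᵐ x ∂P, Q x < ⊤ := by
    refine ae_lt_top mQ ?_
    have : ∫⁻ x, Q x ∂P = 1 := by
      have := hprob₁.measure_univ
      rwa [hfst, withDensity_apply _ MeasurableSet.univ, Measure.restrict_univ] at this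
    simp [this]
  have hγeq : γ = ((γ.map Prod.fst).prod U).withDensity
      (fun p => ENNReal.ofReal (F p) * (Q p.1)⁻¹) := by
    rw [hfst, prod_withDensity_left mQ, ← withDensity_mul _ (by fun_prop) (by fun_prop), hγ]
    refine withDensity_congr_ae ?_
    filter_upwards [Measure.quasiMeasurePreserving_fst.ae hQtop] with p hp
    simp only [Pi.mul_apply]
    rw [mul_comm, mul_assoc, ENNReal.inv_mul_cancel (hQ0 _) hp.ne, mul_one]
  have hacγ : γ ≪ (γ.map Prod.fst).prod U := by
    conv_lhs => rw [hγeq]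
    exact withDensity_absolutelyContinuous _ _
  have h1 : llr γ ((γ.map Prod.fst).prod U) =ᵐ[γ]
      fun p => Real.log (F p) - Real.log (Q p.1).toReal := by
    have h := Measure.rnDeriv_withDensity ((γ.map Prod.fst).prod U)
      (f := fun p => ENNReal.ofReal (F p) * (Q p.1)⁻¹) (by fun_prop)
    rw [← hγeq] at h
    filter_upwards [hacγ.ae_le h, ae_of_ae_map measurable_fst.aemeasurable (hac.ae_le hQtop)]
      with p hp hp'
    have : 0 < (Q p.1).toReal := ENNReal.toReal_pos (hQ0 _) hp'.ne
    rw [llr, hp, ENNReal.toReal_mul, ENNReal.toReal_inv, ENNReal.toReal_ofReal (hpos p).le,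
      Real.log_mul (hpos p).ne' (by positivity), Real.log_inv]
    ring
  have h2 : llr (γ.map Prod.fst) P =ᵐ[γ.map Prod.fst] fun x => Real.log (Q x).toReal := by
    have h := Measure.rnDeriv_withDensity P mQ
    rw [← hfst] at h
    filter_upwards [hac.ae_le h] with x hx
    rw [llr, hx]
  have hlogγ : Integrable (fun p => Real.log (F p)) γ :=
    (hlog.smul_measure ENNReal.ofReal_ne_top).mono_measure hle
  have hlogqγ : Integrable (fun p : α × β => Real.log (Q p.1).toReal) γ :=
    ((hlogq.comp_fst U).smul_measure ENNReal.ofReal_ne_top).mono_measure hle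
  have hm : AEStronglyMeasurable (fun x => Real.log (Q x).toReal) (γ.map Prod.fst) :=
    (by fun_prop : Measurable fun x => Real.log (Q x).toReal).aestronglyMeasurable
  have hlogqπ : Integrable (fun x => Real.log (Q x).toReal) (γ.map Prod.fst) :=
    (integrable_map_measure hm measurable_fst.aemeasurable).2 hlogqγ
  have i1 : Integrable (llr γ ((γ.map Prod.fst).prod U)) γ :=
    (hlogγ.sub hlogqγ).congr h1.symm
  have i2 : Integrable (llr (γ.map Prod.fst) P) (γ.map Prod.fst) := hlogqπ.congr h2.symm
  have n1 := integral_llr_nonneg hacγ i1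
  have n2 := integral_llr_nonneg hac i2
  have hsum : ∫ p, llr γ ((γ.map Prod.fst).prod U) p ∂γ
      + ∫ x, llr (γ.map Prod.fst) P x ∂(γ.map Prod.fst) = ∫ p, Real.log (F p) ∂γ := by
    rw [integral_congr_ae h1, integral_congr_ae h2, integral_sub hlogγ hlogqγ,
      integral_map measurable_fst.aemeasurable hm]
    ring
  refine ⟨γ, hprob, hsnd, hac, hle, ?_, ?_⟩
  · rw [mutualInfo, hsnd, KLdiv_of_integrable hacγ i1, KLdiv_of_integrable hac i2,
      ← ENNReal.ofReal_add n1 n2, hsum]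
  · rw [← hsum]
    positivity

lemma norm_sub_sq_le {E : Type*} [NormedAddCommGroup E] (x y : E) :
    ‖x - y‖ ^ 2 ≤ 2 * (‖x‖ ^ 2 + ‖y‖ ^ 2) := by
  have h := norm_sub_le x y
  have h' : ‖x - y‖ ^ 2 ≤ (‖x‖ + ‖y‖) ^ 2 := by gcongr
  nlinarith [sq_nonneg (‖x‖ - ‖y‖)]

lemma integrable_of_norm_le_one {α : Type*} [MeasurableSpace α] {μ : Measure α}
    [IsFiniteMeasure μ] {f : α → ℝ} (hf : Measurable f) (h : ∀ x, ‖f x‖ ≤ 1) : Integrable f μ :=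
  Integrable.of_bound hf.aestronglyMeasurable 1 (ae_of_all _ h)

section RelaxedEOT

variable {E : Type*} [NormedAddCommGroup E] [MeasurableSpace E]

/-- The Gaussian smoothing of `P`, without its normalizing constant. -/
def gaussSmooth (σ : ℝ) (P : Measure E) (y : E) : ℝ :=
  ∫ x, Real.exp (-‖x - y‖ ^ 2 / (2 * σ ^ 2)) ∂P

variable [BorelSpace E]

lemma gaussKernel_le_one {E : Type*} [NormedAddCommGroup E] (σ : ℝ) (x y : E) :
    Real.exp (-‖x - y‖ ^ 2 / (2 * σ ^ 2)) ≤ 1 := by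
  rw [Real.exp_le_one_iff, neg_div, neg_nonpos]
  positivity

lemma integrable_gaussKernel (σ : ℝ) (P : Measure E) [IsProbabilityMeasure P] (y : E) :
    Integrable (fun x => Real.exp (-‖x - y‖ ^ 2 / (2 * σ ^ 2))) P := by
  refine integrable_of_norm_le_one (by fun_prop) fun x => ?_
  rw [Real.norm_of_nonneg (Real.exp_pos _).le]
  exact gaussKernel_le_one σ x y

lemma gaussSmooth_pos (σ : ℝ) (P : Measure E) [IsProbabilityMeasure P] (y : E) :
    0 < gaussSmooth σ P y :=
  integral_exp_pos (integrable_gaussKernel σ P y)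

lemma gaussSmooth_le_one (σ : ℝ) (P : Measure E) [IsProbabilityMeasure P] (y : E) :
    gaussSmooth σ P y ≤ 1 := by
  calc gaussSmooth σ P y ≤ ∫ _, (1 : ℝ) ∂P :=
        integral_mono (integrable_gaussKernel σ P y) (integrable_const _)
          fun x => gaussKernel_le_one σ x y
    _ = 1 := by simp

variable {σ : ℝ} {P U : Measure E}
  [IsProbabilityMeasure P] [IsProbabilityMeasure U]

@[fun_prop]
lemma measurable_gaussSmooth [SecondCountableTopology E] (σ : ℝ) (P : Measure E) [IsProbabilityMeasure P] :
    Measurable (gaussSmooth σ P) := by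
  have : StronglyMeasurable
      (fun p : E × E => Real.exp (-‖p.1 - p.2‖ ^ 2 / (2 * σ ^ 2))) :=
    (by fun_prop : Measurable _).stronglyMeasurable
  exact this.integral_prod_left'.measurable

/-- On bounded sets the smoothing is bounded below. -/
lemma exists_le_gaussSmooth (hσ : 0 < σ) (P : Measure E) [IsProbabilityMeasure P] (K : ℝ) :
    ∃ δ > 0, ∀ y, ‖y‖ ≤ K → δ ≤ gaussSmooth σ P y := by
  have hi : Integrable (fun x : E => Real.exp (-(‖x‖ ^ 2 + K ^ 2) / σ ^ 2)) P := by
    refine integrable_of_norm_le_one (by fun_prop) fun x => ?_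
    rw [Real.norm_of_nonneg (Real.exp_pos _).le, Real.exp_le_one_iff, neg_div, neg_nonpos]
    positivity
  refine ⟨_, integral_exp_pos hi, fun y hy => ?_⟩
  refine integral_mono hi (integrable_gaussKernel σ P y) fun x => ?_
  have h := norm_sub_sq_le x y
  have : ‖y‖ ^ 2 ≤ K ^ 2 := by gcongr
  simp only
  rw [Real.exp_le_exp, div_le_div_iff₀ (by positivity) (by positivity)]
  nlinarith [mul_le_mul_of_nonneg_right (h.trans (by gcongr :
    2 * (‖x‖ ^ 2 + ‖y‖ ^ 2) ≤ 2 * (‖x‖ ^ 2 + K ^ 2))) (sq_nonneg σ)]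

lemma integrable_log_gaussSmooth [SecondCountableTopology E] (hσ : 0 < σ) {K : ℝ} (hK : ∀ᵐ y ∂U, ‖y‖ ≤ K) :
    Integrable (fun y => Real.log (gaussSmooth σ P y)) U := by
  obtain ⟨δ, hδ, h⟩ := exists_le_gaussSmooth hσ P K
  refine Integrable.of_bound (by fun_prop : Measurable _).aestronglyMeasurable (-Real.log δ) ?_
  filter_upwards [hK] with y hy
  rw [Real.norm_of_nonpos (Real.log_nonpos (gaussSmooth_pos σ P y).le (gaussSmooth_le_one σ P y))]
  exact neg_le_neg (Real.log_le_log hδ (h y hy))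

/-- The density of the optimal plan with respect to `P ⊗ U`. -/
def gibbsDensity (σ : ℝ) (P : Measure E) (p : E × E) : ℝ :=
  Real.exp (-‖p.1 - p.2‖ ^ 2 / (2 * σ ^ 2)) / gaussSmooth σ P p.2

@[fun_prop]
lemma measurable_gibbsDensity [SecondCountableTopology E] (σ : ℝ) (P : Measure E) [IsProbabilityMeasure P] :
    Measurable (gibbsDensity σ P) := by
  unfold gibbsDensity
  fun_prop

lemma gibbsDensity_pos (σ : ℝ) (P : Measure E) [IsProbabilityMeasure P] (p : E × E) :
    0 < gibbsDensity σ P p :=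
  div_pos (Real.exp_pos _) (gaussSmooth_pos σ P _)

lemma log_gibbsDensity (σ : ℝ) (P : Measure E) [IsProbabilityMeasure P] (p : E × E) :
    Real.log (gibbsDensity σ P p) =
      -(1 / σ ^ 2) * (‖p.1 - p.2‖ ^ 2 / 2) - Real.log (gaussSmooth σ P p.2) := by
  rw [gibbsDensity, Real.log_div (Real.exp_pos _).ne' (gaussSmooth_pos σ P _).ne', Real.log_exp]
  congr 1
  rw [div_mul_eq_div_div, neg_div, neg_div]
  ring

lemma lintegral_gibbsDensity (σ : ℝ) (P : Measure E) [IsProbabilityMeasure P] (y : E) :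
    ∫⁻ x, ENNReal.ofReal (gibbsDensity σ P (x, y)) ∂P = 1 := by
  have hi : Integrable (fun x => gibbsDensity σ P (x, y)) P :=
    (integrable_gaussKernel σ P y).div_const (gaussSmooth σ P y)
  rw [← ofReal_integral_eq_lintegral_ofReal hi (ae_of_all _ fun x => (gibbsDensity_pos σ P (x, y)).le)]
  have : ∫ x, gibbsDensity σ P (x, y) ∂P = 1 := by
    simp only [gibbsDensity, integral_div]
    exact div_self (gaussSmooth_pos σ P y).ne'
  rw [this, ENNReal.ofReal_one]

lemma integral_log_gibbsDensity [SecondCountableTopology E] {γ : Measure (E × E)} (hsnd : γ.map Prod.snd = U)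
    (hc : Integrable (fun p : E × E => ‖p.1 - p.2‖ ^ 2 / 2) γ)
    (hg : Integrable (fun y => Real.log (gaussSmooth σ P y)) U) :
    Integrable (fun p => Real.log (gibbsDensity σ P p)) γ ∧
      ∫ p, Real.log (gibbsDensity σ P p) ∂γ =
        -(1 / σ ^ 2) * ∫ p, ‖p.1 - p.2‖ ^ 2 / 2 ∂γ - ∫ y, Real.log (gaussSmooth σ P y) ∂U := by
  subst hsnd
  have hg' : Integrable (fun p : E × E => Real.log (gaussSmooth σ P p.2)) γ :=
    hg.comp_measurable measurable_snd
  simp_rw [log_gibbsDensity]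
  refine ⟨(hc.const_mul _).sub hg', ?_⟩
  rw [integral_sub (hc.const_mul _) hg', integral_const_mul,
    integral_map measurable_snd.aemeasurable (by fun_prop : Measurable _).aestronglyMeasurable]

/-- The relaxed entropic optimal transport distance to a boundedly supported `U` is the averaged
negative log-likelihood under Gaussian smoothing, scaled by `σ²`. -/
lemma relaxedEOT_eq [SecondCountableTopology E] (hσ : 0 < σ) (hmom : Integrable (fun x => ‖x‖ ^ 2) P) {K : ℝ}
    (hK : ∀ᵐ y ∂U, ‖y‖ ≤ K) :
    relaxedEOT σ P U = ENNReal.ofReal (-σ ^ 2 * ∫ y, Real.log (gaussSmooth σ P y) ∂U) := by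
  have hg := integrable_log_gaussSmooth (P := P) hσ hK
  have hs : 0 < σ ^ 2 := by positivity
  apply le_antisymm
  · obtain ⟨δ, hδ, hδg⟩ := exists_le_gaussSmooth hσ P K
    have hK' : ∀ᵐ p ∂(P.prod U), ‖p.2‖ ≤ K := Measure.quasiMeasurePreserving_snd.ae hK
    have hM : ∀ᵐ p ∂(P.prod U), gibbsDensity σ P p ≤ 1 / δ := by
      filter_upwards [hK'] with p hp
      exact div_le_div₀ zero_le_one (gaussKernel_le_one σ _ _) hδ (hδg _ hp)
    have hc : Integrable (fun p : E × E => ‖p.1 - p.2‖ ^ 2 / 2) (P.prod U) := by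
      refine Integrable.mono' ((hmom.comp_fst U).add (integrable_const (K ^ 2)))
        (by fun_prop : Measurable _).aestronglyMeasurable ?_
      filter_upwards [hK'] with p hp
      rw [Real.norm_of_nonneg (by positivity)]
      have h := norm_sub_sq_le p.1 p.2
      have : ‖p.2‖ ^ 2 ≤ K ^ 2 := by gcongr
      simp only [Pi.add_apply]
      linarith
    have hlog := (integral_log_gibbsDensity (σ := σ) (P := P) (by simp [Measure.map_snd_prod])
      hc hg).1
    have hlogq : Integrable (fun x => Real.log
        (∫⁻ y, ENNReal.ofReal (gibbsDensity σ P (x, y)) ∂U).toReal) P := by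
      have hm : Measurable fun x => ∫⁻ y, ENNReal.ofReal (gibbsDensity σ P (x, y)) ∂U :=
        Measurable.lintegral_prod_right' (f := fun p => ENNReal.ofReal (gibbsDensity σ P p))
          (by fun_prop)
      refine Integrable.mono' (((hmom.add (integrable_const (K ^ 2))).div_const (σ ^ 2)).add
        (integrable_const |Real.log (1 / δ)|))
        (by fun_prop : Measurable _).aestronglyMeasurable (ae_of_all _ fun x => ?_)
      set Q := ∫⁻ y, ENNReal.ofReal (gibbsDensity σ P (x, y)) ∂U
      have hup : Q ≤ ENNReal.ofReal (1 / δ) := by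
        calc Q ≤ ∫⁻ _, ENNReal.ofReal (1 / δ) ∂U := by
              refine lintegral_mono_ae ?_
              filter_upwards [hK] with y hy
              exact ENNReal.ofReal_le_ofReal
                (div_le_div₀ zero_le_one (gaussKernel_le_one σ _ _) hδ (hδg _ hy))
          _ = _ := by simp
      have hlow : ENNReal.ofReal (Real.exp (-((‖x‖ ^ 2 + K ^ 2) / σ ^ 2))) ≤ Q := by
        calc _ = ∫⁻ _, ENNReal.ofReal (Real.exp (-((‖x‖ ^ 2 + K ^ 2) / σ ^ 2))) ∂U := by simp
          _ ≤ Q := by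
              refine lintegral_mono_ae ?_
              filter_upwards [hK] with y hy
              refine ENNReal.ofReal_le_ofReal ?_
              rw [← Real.le_log_iff_exp_le (gibbsDensity_pos σ P _), log_gibbsDensity]
              have h1 := Real.log_nonpos (gaussSmooth_pos σ P y).le (gaussSmooth_le_one σ P y)
              have h2 := norm_sub_sq_le x y
              have h3 : ‖y‖ ^ 2 ≤ K ^ 2 := by gcongr
              have h4 : 1 / σ ^ 2 * (‖x - y‖ ^ 2 / 2) ≤ 1 / σ ^ 2 * (‖x‖ ^ 2 + K ^ 2) := by
                gcongr
                linarith
              have h5 : (‖x‖ ^ 2 + K ^ 2) / σ ^ 2 = 1 / σ ^ 2 * (‖x‖ ^ 2 + K ^ 2) := by ring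
              simp only
              linarith
      have hup' := ENNReal.toReal_le_of_le_ofReal (by positivity) hup
      have hlow' := (ENNReal.ofReal_le_iff_le_toReal
        (hup.trans_lt ENNReal.ofReal_lt_top).ne).1 hlow
      have hpos : 0 < Q.toReal := (Real.exp_pos _).trans_le hlow'
      have l1 := Real.log_le_log hpos hup'
      rw [← Real.le_log_iff_exp_le hpos] at hlow'
      have hnn : 0 ≤ (‖x‖ ^ 2 + K ^ 2) / σ ^ 2 := by positivity
      have := le_abs_self (Real.log (1 / δ))
      have := abs_nonneg (Real.log (1 / δ))
      simp only [Pi.add_apply]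
      rw [Real.norm_eq_abs, abs_le]
      constructor <;> linarith
    obtain ⟨γ, hγ, hsnd, hac, hle, hdiv, hnn⟩ := exists_divergence_le
      (measurable_gibbsDensity σ P) (gibbsDensity_pos σ P) (lintegral_gibbsDensity σ P)
      hM hlog hlogq
    have hcγ := (hc.smul_measure ENNReal.ofReal_ne_top).mono_measure hle
    have hval := (integral_log_gibbsDensity (σ := σ) (P := P) hsnd hcγ hg).2
    refine (iInf₂_le γ ⟨hγ, hsnd, hac⟩).trans ?_
    calc _ ≤ ENNReal.ofReal (∫ p, ‖p.1 - p.2‖ ^ 2 / 2 ∂γ) + ENNReal.ofReal (σ ^ 2) *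
          ENNReal.ofReal (∫ p, Real.log (gibbsDensity σ P p) ∂γ) := by
          rw [ofReal_integral_eq_lintegral_ofReal hcγ (ae_of_all _ fun p => by positivity)]
          gcongr
      _ = _ := by
          rw [← ENNReal.ofReal_mul hs.le, ← ENNReal.ofReal_add
            (integral_nonneg fun p => by positivity) (mul_nonneg hs.le hnn), hval]
          congr 1
          field_simp
          ring
  · refine le_iInf₂ fun γ ⟨hγ, hsnd, hac⟩ => ?_
    by_cases htop : (∫⁻ p, ENNReal.ofReal (‖p.1 - p.2‖ ^ 2 / 2) ∂γ)
      + ENNReal.ofReal (σ ^ 2) * (mutualInfo γ + KLdiv (γ.map Prod.fst) P) = ⊤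
    · rw [htop]
      exact le_top
    obtain ⟨h1, h2⟩ := not_or.1 (mt ENNReal.add_eq_top.2 htop)
    have h3 : mutualInfo γ + KLdiv (γ.map Prod.fst) P ≠ ⊤ := fun h => h2 <| by
      rw [h]
      exact ENNReal.mul_top (by simpa using hσ.ne')
    obtain ⟨h4, h5⟩ := not_or.1 (mt ENNReal.add_eq_top.2 h3)
    rw [mutualInfo, hsnd] at h4 ⊢
    obtain ⟨hacγ, i1, e1⟩ := KLdiv_ne_top h4
    obtain ⟨-, i2, e2⟩ := KLdiv_ne_top h5
    have hcγ : Integrable (fun p : E × E => ‖p.1 - p.2‖ ^ 2 / 2) γ :=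
      (lintegral_ofReal_ne_top_iff_integrable
        (by fun_prop : Measurable _).aestronglyMeasurable
        (ae_of_all _ fun p => by positivity)).1 h1
    obtain ⟨hlog, hval⟩ := integral_log_gibbsDensity (σ := σ) (P := P) hsnd hcγ hg
    have hgibbs := integral_log_le_integral_llr_add (measurable_gibbsDensity σ P)
      (gibbsDensity_pos σ P) (P := P) (U := U) (by
        rw [lintegral_prod_symm' _ (by fun_prop)]
        simp [lintegral_gibbsDensity]) hac hacγ hlog i1 i2
    rw [e1, e2, ← ofReal_integral_eq_lintegral_ofReal hcγ (ae_of_all _ fun p => by positivity)]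
    set a := ∫ p, llr γ ((γ.map Prod.fst).prod U) p ∂γ
    set b := ∫ x, llr (γ.map Prod.fst) P x ∂(γ.map Prod.fst)
    set c := ∫ p, ‖p.1 - p.2‖ ^ 2 / 2 ∂γ
    have hreal : -σ ^ 2 * ∫ y, Real.log (gaussSmooth σ P y) ∂U ≤ c + σ ^ 2 * (a + b) := by
      rw [hval] at hgibbs
      have := mul_le_mul_of_nonneg_left hgibbs hs.le
      have hcan : σ ^ 2 * (-(1 / σ ^ 2) * c - ∫ y, Real.log (gaussSmooth σ P y) ∂U)
          = -c + -σ ^ 2 * ∫ y, Real.log (gaussSmooth σ P y) ∂U := by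
        field_simp
        ring
      linarith
    calc _ ≤ ENNReal.ofReal (c + σ ^ 2 * (a + b)) := ENNReal.ofReal_le_ofReal hreal
      _ ≤ ENNReal.ofReal c + ENNReal.ofReal (σ ^ 2 * (a + b)) := ENNReal.ofReal_add_le
      _ ≤ _ := by
          rw [ENNReal.ofReal_mul hs.le]
          gcongr
          exact ENNReal.ofReal_add_le

end RelaxedEOT

lemma integral_empirical {α : Type*} [MeasurableSpace α] [MeasurableSingletonClass α] {n : ℕ}
    (y : Fin n → α) (f : α → ℝ) :
    ∫ x, f x ∂(empirical y) = (n : ℝ)⁻¹ * ∑ i, f (y i) := by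
  rw [empirical, integral_smul_measure, integral_finsetSum_measure]
  · simp
  · intro i _
    exact integrable_dirac (by simp)

lemma isProbabilityMeasure_empirical {α : Type*} [MeasurableSpace α] {n : ℕ} (hn : 0 < n)
    (y : Fin n → α) : IsProbabilityMeasure (empirical y) := by
  constructor
  simp only [empirical, Measure.smul_apply, Measure.finsetSum_apply, measure_univ,
    Finset.sum_const, Finset.card_univ, Fintype.card_fin, smul_eq_mul, nsmul_eq_mul, mul_one]
  exact ENNReal.inv_mul_cancel (by exact_mod_cast hn.ne') (by simp)

lemma ae_empirical {α : Type*} [MeasurableSpace α] [MeasurableSingletonClass α] {n : ℕ}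
    (y : Fin n → α) {p : α → Prop} (h : ∀ i, p (y i)) : ∀ᵐ x ∂(empirical y), p x := by
  rw [empirical]
  refine Measure.ae_smul_measure ?_ _
  rw [ae_iff, Measure.finsetSum_apply]
  exact Finset.sum_eq_zero fun i _ => by simpa [← ae_iff, ae_dirac_eq] using h i

/-- For any class `Pclass` of probability measures on `ℝ^d` with finite second moments
(not necessarily closed under domination), `P̂ ∈ Pclass` maximizes the Gaussian
deconvolution log-likelihood over `Pclass` if and only if it minimizes the relaxed
entropic optimal transport distance `P ↦ W^{rel}_{σ²}(P, U)` over `Pclass`. -/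
theorem mle_iff_relaxedEOT_proj {d n : ℕ} (hn : 0 < n) (σ : ℝ) (hσ : 0 < σ)
    (y : Fin n → EuclideanSpace ℝ (Fin d))
    (Pclass : Set (Measure (EuclideanSpace ℝ (Fin d))))
    (hprob : ∀ P ∈ Pclass, IsProbabilityMeasure P)
    (hmom : ∀ P ∈ Pclass, Integrable (fun x => ‖x‖ ^ 2) P)
    (Phat : Measure (EuclideanSpace ℝ (Fin d))) (hPhat : Phat ∈ Pclass) :
    (∀ P ∈ Pclass, ∑ i, Real.log (∫ x, gaussDensity σ d (y i - x) ∂P)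
        ≤ ∑ i, Real.log (∫ x, gaussDensity σ d (y i - x) ∂Phat)) ↔
    (∀ P ∈ Pclass, relaxedEOT σ Phat (empirical y) ≤ relaxedEOT σ P (empirical y)) := by
  have hC : 0 < (2 * π * σ ^ 2) ^ (-(d : ℝ) / 2) := by positivity
  have := isProbabilityMeasure_empirical hn y
  have hn' : (0 : ℝ) < n := by exact_mod_cast hn
  have hK : ∀ᵐ z ∂(empirical y), ‖z‖ ≤ ∑ i, ‖y i‖ := ae_empirical y fun i =>
    Finset.single_le_sum (f := fun i => ‖y i‖) (fun _ _ => norm_nonneg _) (Finset.mem_univ i)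
  have hlik : ∀ P ∈ Pclass, ∑ i, Real.log (∫ x, gaussDensity σ d (y i - x) ∂P) =
      n * Real.log ((2 * π * σ ^ 2) ^ (-(d : ℝ) / 2)) + ∑ i, Real.log (gaussSmooth σ P (y i)) := by
    intro P hP
    have := hprob P hP
    have h : ∀ i, Real.log (∫ x, gaussDensity σ d (y i - x) ∂P) =
        Real.log ((2 * π * σ ^ 2) ^ (-(d : ℝ) / 2)) + Real.log (gaussSmooth σ P (y i)) := by
      intro i
      rw [← Real.log_mul hC.ne' (gaussSmooth_pos σ P _).ne']
      simp only [gaussDensity, integral_const_mul, gaussSmooth, norm_sub_rev (y i)]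
    simp [h, Finset.sum_add_distrib]
  have heot : ∀ P ∈ Pclass, relaxedEOT σ P (empirical y) =
      ENNReal.ofReal (-σ ^ 2 * ((n : ℝ)⁻¹ * ∑ i, Real.log (gaussSmooth σ P (y i)))) := by
    intro P hP
    have := hprob P hP
    rw [relaxedEOT_eq hσ (hmom P hP) hK, integral_empirical]
  refine forall₂_congr fun P hP => ?_
  have := hprob P hP
  have hnonpos : ∑ i, Real.log (gaussSmooth σ P (y i)) ≤ 0 := Finset.sum_nonpos fun i _ =>
    Real.log_nonpos (gaussSmooth_pos σ P _).le (gaussSmooth_le_one σ P _)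
  have hk : 0 < σ ^ 2 * (n : ℝ)⁻¹ := by positivity
  have hrw : ∀ t : ℝ, -σ ^ 2 * ((n : ℝ)⁻¹ * t) = σ ^ 2 * (n : ℝ)⁻¹ * (-t) := fun t => by ring
  rw [hlik P hP, hlik Phat hPhat, heot P hP, heot Phat hPhat, hrw, hrw,
    ENNReal.ofReal_le_ofReal_iff (mul_nonneg hk.le (neg_nonneg.2 hnonpos)),
    mul_le_mul_iff_right₀ hk, neg_le_neg_iff, add_le_add_iff_left]

end
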